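/- For every positive integer k, the number of integer vectors z ∈ ℤ^6 with z₁² + ⋯ + z₆² = k is at least binomial(k + 2, 2). -/

import Mathlib

open Finset in
lemma chi_mult (a b : ℕ) (h : a.Coprime b) :
    ∑ d ∈ (a*b).divisors, ZMod.χ₄ (d:ZMod 4) =
      (∑ d ∈ a.divisors, ZMod.χ₄ (d:ZMod 4)) * ∑ d ∈ b.divisors, ZMod.χ₄ (d:ZMod 4) := by
  let f : ArithmeticFunction ℤ := ⟨fun n => ZMod.χ₄ (n : ZMod 4), by simp⟩
  have hf : f.IsMultiplicative := by
    refine ⟨by simp [f], ?_⟩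
    intro m n _
    change ZMod.χ₄ ((m*n : ℕ) : ZMod 4) = ZMod.χ₄ (m : ZMod 4) * ZMod.χ₄ (n : ZMod 4)
    rw [Nat.cast_mul, map_mul]
  have h2 := (hf.mul ArithmeticFunction.isMultiplicative_zeta.natCast).map_mul_of_coprime h
  simp only [ArithmeticFunction.coe_mul_zeta_apply] at h2
  exact h2

/-- a finite family of Gaussian integers of norm `w`, no one dividing another -/
def GoodFam (w : ℕ) (T : Finset GaussianInt) : Prop :=
  (∀ α ∈ T, Zsqrtd.norm α = w) ∧ (∀ α ∈ T, ∀ β ∈ T, α ∣ β → α = β) ∧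
    (T.card : ℤ) = ∑ d ∈ w.divisors, ZMod.χ₄ (d:ZMod 4)

lemma coprime_of_norm {α β : GaussianInt} {a b : ℕ} (h : a.Coprime b)
    (ha : Zsqrtd.norm α = a) (hb : Zsqrtd.norm β = b) : IsCoprime α β := by
  have h1 : IsCoprime ((a:ℤ) : GaussianInt) ((b:ℤ) : GaussianInt) :=
    (Nat.isCoprime_iff_coprime.2 h).map (Int.castRingHom GaussianInt)
  rw [← ha, ← hb, Zsqrtd.norm_eq_mul_conj, Zsqrtd.norm_eq_mul_conj] at h1
  exact h1.of_mul_left_left.of_mul_right_left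

lemma norm_dvd {α β : GaussianInt} (h : α ∣ β) : Zsqrtd.norm α ∣ Zsqrtd.norm β := by
  obtain ⟨c, rfl⟩ := h
  rw [Zsqrtd.norm_mul]; exact dvd_mul_right _ _

lemma good_mul {a b : ℕ} (h : a.Coprime b) {S T : Finset GaussianInt}
    (hS : GoodFam a S) (hT : GoodFam b T) : ∃ U, GoodFam (a*b) U := by
  classical
  obtain ⟨s1, s2, s3⟩ := hS
  obtain ⟨t1, t2, t3⟩ := hT
  have key : ∀ α ∈ S, ∀ β ∈ T, ∀ α' ∈ S, ∀ β' ∈ T, α * β ∣ α' * β' → α = α' ∧ β = β' := by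
    intro α hα β hβ α' hα' β' hβ' hd
    constructor
    · apply s2 _ hα _ hα'
      exact (coprime_of_norm h (s1 _ hα) (t1 _ hβ')).dvd_of_dvd_mul_right
        ((dvd_mul_right _ _).trans hd)
    · apply t2 _ hβ _ hβ'
      exact (coprime_of_norm h (s1 _ hα') (t1 _ hβ)).symm.dvd_of_dvd_mul_left
        ((dvd_mul_left _ _).trans hd)
  refine ⟨(S ×ˢ T).image (fun x => x.1 * x.2), ?_, ?_, ?_⟩
  · intro x hx
    simp only [Finset.mem_image, Finset.mem_product, Prod.exists] at hx
    obtain ⟨α, β, ⟨hα, hβ⟩, rfl⟩ := hx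
    rw [Zsqrtd.norm_mul, s1 _ hα, t1 _ hβ]; push_cast; rfl
  · intro x hx y hy hxy
    simp only [Finset.mem_image, Finset.mem_product, Prod.exists] at hx hy
    obtain ⟨α, β, ⟨hα, hβ⟩, rfl⟩ := hx
    obtain ⟨α', β', ⟨hα', hβ'⟩, rfl⟩ := hy
    obtain ⟨h1, h2⟩ := key _ hα _ hβ _ hα' _ hβ' hxy
    rw [h1, h2]
  · rw [Finset.card_image_of_injOn, Finset.card_product, chi_mult _ _ h, ← s3, ← t3]
    · push_cast; rfl
    · rintro ⟨α, β⟩ h1 ⟨α', β'⟩ h2 he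
      simp only [Finset.coe_product, Set.mem_prod, Finset.mem_coe] at h1 h2 he
      obtain ⟨h3, h4⟩ := key _ h1.1 _ h1.2 _ h2.1 _ h2.2 (by rw [he])
      rw [h3, h4]

lemma norm_npow (α : GaussianInt) (n : ℕ) : Zsqrtd.norm (α ^ n) = (Zsqrtd.norm α) ^ n :=
  map_pow (Zsqrtd.normMonoidHom (d := -1)) α n

lemma good_one (p n : ℕ) (hp : p.Prime) (h1 : p % 4 = 1) : ∃ U, GoodFam (p^n) U := by
  classical
  have := Fact.mk hp
  obtain ⟨a, b, hab⟩ := Nat.Prime.sq_add_sq (p := p) (by omega)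
  have hpo : p % 2 = 1 := by omega
  let π : GaussianInt := ⟨a, b⟩
  let ρ : GaussianInt := ⟨a, -b⟩
  have hπ : Zsqrtd.norm π = p := by rw [Zsqrtd.norm_def, ← hab]; push_cast; simp only [π]; ring
  have hρ : Zsqrtd.norm ρ = p := by rw [Zsqrtd.norm_def, ← hab]; push_cast; simp only [ρ]; ring
  have hmul : π * ρ = ((p:ℤ) : GaussianInt) := by
    have : ((p:ℤ)) = a*a+b*b := by rw [← hab]; push_cast; ring
    rw [this]; apply Zsqrtd.ext <;> simp [π, ρ]; ring
  have hadd : π + ρ = ((2*a:ℤ) : GaussianInt) := by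
    apply Zsqrtd.ext <;> simp [π, ρ] ; ring
  have hcp : Nat.Coprime (2*a) p := by
    apply Nat.Coprime.symm
    rw [hp.coprime_iff_not_dvd]
    intro hd
    rcases hp.dvd_mul.1 hd with h | h
    · have := Nat.le_of_dvd (by norm_num) h
      have := hp.two_le
      have : p = 2 := by omega
      omega
    · have hb : p ∣ b := by
        have : p ∣ b^2 := (Nat.dvd_add_right (dvd_pow h two_ne_zero)).1 (by rw [hab])
        exact hp.dvd_of_dvd_pow this
      have : p^2 ∣ p := by
        conv_rhs => rw [← hab]
        exact dvd_add (pow_dvd_pow_of_dvd h 2) (pow_dvd_pow_of_dvd hb 2)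
      have := Nat.le_of_dvd hp.pos this
      have := hp.two_le
      nlinarith
  have hco : IsCoprime π ρ := by
    obtain ⟨u, v, huv⟩ := Nat.isCoprime_iff_coprime.2 hcp
    refine ⟨u + v * ρ, u, ?_⟩
    have : ((u * (2*a:ℕ) + v * (p:ℕ) : ℤ) : GaussianInt) = 1 := by rw [huv]; simp
    push_cast at this hmul hadd
    linear_combination this + (u:GaussianInt) * hadd + (v : GaussianInt) * hmul
  have key : ∀ i j : ℕ, i ≤ n → j ≤ n → π^i * ρ^(n-i) ∣ π^j * ρ^(n-j) → i = j := by
    intro i j hi hj hd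
    have e1 : π^i ∣ π^j := (hco.pow (m := i) (n := n-j)).dvd_of_dvd_mul_right
      ((dvd_mul_right _ _).trans hd)
    have e2 : ρ^(n-i) ∣ ρ^(n-j) := (hco.symm.pow (m := n-i) (n := j)).dvd_of_dvd_mul_left
      ((dvd_mul_left _ _).trans hd)
    have f1 := norm_dvd e1
    have f2 := norm_dvd e2
    rw [norm_npow, norm_npow, hπ] at f1
    rw [norm_npow, norm_npow, hρ] at f2
    norm_cast at f1 f2
    rw [Nat.pow_dvd_pow_iff_le_right hp.one_lt] at f1 f2
    omega
  refine ⟨(Finset.range (n+1)).image (fun i => π^i * ρ^(n-i)), ?_, ?_, ?_⟩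
  · intro x hx
    simp only [Finset.mem_image, Finset.mem_range] at hx
    obtain ⟨i, hi, rfl⟩ := hx
    rw [Zsqrtd.norm_mul, norm_npow, norm_npow, hπ, hρ, ← pow_add]
    push_cast; congr 1; omega
  · intro x hx y hy hxy
    simp only [Finset.mem_image, Finset.mem_range] at hx hy
    obtain ⟨i, hi, rfl⟩ := hx
    obtain ⟨j, hj, rfl⟩ := hy
    rw [key i j (by omega) (by omega) hxy]
  · rw [Finset.card_image_of_injOn, Nat.sum_divisors_prime_pow hp]
    · simp only [Nat.cast_pow, map_pow, ZMod.χ₄_nat_one_mod_four h1]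
      simp
    · intro i hi j hj he
      simp only [Finset.coe_range, Set.mem_Iio] at hi hj
      exact key i j (by omega) (by omega) (by simp only at he; rw [he])

lemma good_three (p n : ℕ) (hp : p.Prime) (h1 : p % 4 = 3) : ∃ U, GoodFam (p^n) U := by
  classical
  have hs : ∑ d ∈ (p^n).divisors, ZMod.χ₄ (d:ZMod 4) = if n % 2 = 0 then 1 else 0 := by
    rw [Nat.sum_divisors_prime_pow hp]
    simp only [Nat.cast_pow, map_pow, ZMod.χ₄_nat_three_mod_four h1]
    rw [neg_one_geom_sum]
    simp only [Nat.even_iff]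
    split_ifs <;> omega
  by_cases hn : n % 2 = 0
  · refine ⟨{((p^(n/2) : ℕ) : GaussianInt)}, ?_, ?_, ?_⟩
    · simp only [Finset.mem_singleton]
      rintro _ rfl
      rw [Zsqrtd.norm_natCast, ← Nat.cast_mul, ← pow_add]
      congr 2; omega
    · simp
    · rw [hs, if_pos hn]; simp
  · refine ⟨∅, by simp, by simp, ?_⟩
    rw [hs, if_neg hn]; simp

lemma good_exists (w : ℕ) : w % 2 = 1 → ∃ U, GoodFam w U := by
  induction w using Nat.recOnPosPrimePosCoprime with
  | zero => intro h; omega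
  | one =>
    intro _
    refine ⟨{1}, by simp, by simp, by simp⟩
  | prime_pow p n hp hn =>
    intro h
    have hp2 : p % 2 = 1 := by
      rcases Nat.mod_two_eq_zero_or_one p with h0 | h0
      · have := (Nat.even_iff.2 h0).pow_of_ne_zero hn.ne'
        rw [Nat.even_iff] at this; omega
      · exact h0
    rcases (by omega : p % 4 = 1 ∨ p % 4 = 3) with h1 | h1
    · exact good_one p n hp h1
    · exact good_three p n hp h1
  | coprime a b _ _ hab iha ihb =>
    intro h
    have := Nat.odd_mul.1 (Nat.odd_iff.2 h)
    obtain ⟨S, hS⟩ := iha (Nat.odd_iff.1 this.1)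
    obtain ⟨T, hT⟩ := ihb (Nat.odd_iff.1 this.2)
    exact good_mul hab hS hT
def QQ (m : ℕ) : Finset (ℕ × ℕ × ℕ × ℕ) :=
  (Finset.range (2*m+1) ×ˢ Finset.range (2*m+1) ×ˢ Finset.range (2*m+1) ×ˢ
    Finset.range (2*m+1)).filter (fun x => x.1 % 2 = 1 ∧ x.2.1 % 2 = 1 ∧ x.2.2.1 % 2 = 1 ∧
      x.2.2.2 % 2 = 1 ∧ x.1 * x.2.1 + x.2.2.1 * x.2.2.2 = 2 * m)

lemma mem_QQ (m d a c b : ℕ) : (d, a, c, b) ∈ QQ m ↔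
    d % 2 = 1 ∧ a % 2 = 1 ∧ c % 2 = 1 ∧ b % 2 = 1 ∧ d * a + c * b = 2 * m := by
  simp only [QQ, Finset.mem_filter, Finset.mem_product, Finset.mem_range, and_iff_right_iff_imp]
  rintro ⟨h1, h2, h3, h4, h5⟩
  have p1 : 0 < d := by omega
  have p2 : 0 < a := by omega
  have p3 : 0 < c := by omega
  have p4 : 0 < b := by omega
  have := Nat.le_mul_of_pos_right d p2
  have := Nat.le_mul_of_pos_left a p1
  have := Nat.le_mul_of_pos_right c p4
  have := Nat.le_mul_of_pos_left b p3
  omega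

lemma chi_pair (d c : ℕ) (hd : d % 2 = 1) (hc : c % 2 = 1) :
    ZMod.χ₄ (d : ZMod 4) * ZMod.χ₄ (c : ZMod 4) = if (d + c) % 4 = 2 then 1 else -1 := by
  rcases (by omega : d % 4 = 1 ∨ d % 4 = 3) with h1 | h1 <;>
  rcases (by omega : c % 4 = 1 ∨ c % 4 = 3) with h2 | h2 <;>
  simp only [ZMod.χ₄_nat_one_mod_four, ZMod.χ₄_nat_three_mod_four, h1, h2] <;>
  split_ifs <;> omega

/-- Dirichlet's sign-reversing involution. -/
def inv4 (x : ℕ × ℕ × ℕ × ℕ) : ℕ × ℕ × ℕ × ℕ :=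
  ((x.2.1 + x.2.2.2) + (x.2.1 + x.2.2.1 / (x.1 - x.2.2.1) * (x.2.1 + x.2.2.2)),
    x.2.2.1 % (x.1 - x.2.2.1),
    x.2.1 + x.2.2.1 / (x.1 - x.2.2.1) * (x.2.1 + x.2.2.2),
    (x.1 - x.2.2.1) - x.2.2.1 % (x.1 - x.2.2.1))

lemma off_diag (m : ℕ) (hm : m % 2 = 1) :
    ∑ x ∈ (QQ m).filter (fun x => x.2.2.1 < x.1),
      ZMod.χ₄ (x.1 : ZMod 4) * ZMod.χ₄ (x.2.2.1 : ZMod 4) = 0 := by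
  -- common data
  have data : ∀ d a c b : ℕ, (d, a, c, b) ∈ QQ m → c < d →
      ∃ e s h r : ℕ, d = c + e ∧ s = a + b ∧ c = e * h + r ∧ r < e ∧ 0 < a ∧ a < s ∧
        d % 2 = 1 ∧ a % 2 = 1 ∧ c % 2 = 1 ∧ b % 2 = 1 ∧ r % 2 = 1 ∧ e % 2 = 0 ∧ s % 2 = 0 ∧
        (e + s) % 4 = 2 ∧ e * a + c * s = 2 * m ∧
        inv4 (d, a, c, b) = (s + (a + h * s), r, a + h * s, e - r) := by
    intro d a c b hx hlt
    rw [mem_QQ] at hx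
    obtain ⟨h1, h2, h3, h4, h5⟩ := hx
    obtain ⟨e, rfl⟩ := Nat.exists_eq_add_of_lt hlt
    have hee : c + e + 1 - c = e + 1 := by omega
    have he : (e+1) % 2 = 0 := by omega
    have hdm := Nat.div_add_mod c (e+1)
    obtain ⟨f, hf⟩ : ∃ f, e + 1 = 2 * f := ⟨(e+1)/2, by omega⟩
    have heq : (e+1) * a + c * (a+b) = 2 * m := by rw [← h5]; ring
    refine ⟨e+1, a+b, c/(e+1), c%(e+1), by omega, rfl, hdm.symm, Nat.mod_lt _ (by omega),
      by omega, by omega, h1, h2, h3, h4, ?_, he, by omega, ?_, heq, ?_⟩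
    · have := Nat.mod_mod_of_dvd c (show 2 ∣ e+1 by omega)
      omega
    · obtain ⟨a', rfl⟩ : ∃ a', a = 2*a'+1 := ⟨a/2, by omega⟩
      obtain ⟨c', rfl⟩ : ∃ c', c = 2*c'+1 := ⟨c/2, by omega⟩
      obtain ⟨b', rfl⟩ : ∃ b', b = 2*b'+1 := ⟨b/2, by omega⟩
      rw [hf] at heq ⊢
      have : 4 * (f*a') + 2 * f + 4 * (c' * (a'+b'+1)) + 2 * (a'+b'+1) = 2 * m := by
        rw [← heq]; ring
      omega
    · simp only [inv4, hee]
  apply Finset.sum_involution (fun x _ => inv4 x)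
  · rintro ⟨d, a, c, b⟩ hx
    rw [Finset.mem_filter] at hx
    obtain ⟨e, s, h, r, q1, q2, q3, q4, q5, q6, q7, q8, q9, q10, q11, q12, q13, q14, q15, q16⟩ :=
      data d a c b hx.1 hx.2
    rw [q16]
    simp only
    obtain ⟨t, ht⟩ : ∃ t, s = 2 * t := ⟨s/2, by omega⟩
    have hpar : (a + h * s) % 2 = 1 := by
      rw [ht, show h * (2*t) = 2 * (h*t) by ring]; omega
    rw [chi_pair _ _ q7 q9, chi_pair _ _ (by omega) hpar]
    generalize a + h * s = z at *
    split_ifs <;> omega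
  · rintro ⟨d, a, c, b⟩ hx _ heq
    rw [Finset.mem_filter] at hx
    obtain ⟨e, s, h, r, q1, q2, q3, q4, q5, q6, q7, q8, q9, q10, q11, q12, q13, q14, q15, q16⟩ :=
      data d a c b hx.1 hx.2
    rw [q16] at heq
    simp only [Prod.mk.injEq] at heq
    omega
  · rintro ⟨d, a, c, b⟩ hx
    rw [Finset.mem_filter] at hx
    obtain ⟨e, s, h, r, q1, q2, q3, q4, q5, q6, q7, q8, q9, q10, q11, q12, q13, q14, q15, q16⟩ :=
      data d a c b hx.1 hx.2
    rw [q16, Finset.mem_filter, mem_QQ]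
    obtain ⟨t, ht⟩ : ∃ t, s = 2 * t := ⟨s/2, by omega⟩
    have hpar : (a + h * s) % 2 = 1 := by
      rw [ht, show h * (2*t) = 2 * (h*t) by ring]; omega
    refine ⟨⟨by omega, q11, hpar, by omega, ?_⟩, by simp only; omega⟩
    obtain ⟨u, rfl⟩ := Nat.exists_eq_add_of_lt q4
    have : r + u + 1 - r = u + 1 := by omega
    rw [this, ← q15, q3]; ring
  · rintro ⟨d, a, c, b⟩ hx
    rw [Finset.mem_filter] at hx
    obtain ⟨e, s, h, r, q1, q2, q3, q4, q5, q6, q7, q8, q9, q10, q11, q12, q13, q14, q15, q16⟩ :=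
      data d a c b hx.1 hx.2
    rw [q16]
    have e1 : s + (a + h * s) - (a + h * s) = s := by omega
    have e2 : (a + h * s) / s = h := by
      rw [Nat.add_mul_div_right _ _ (by omega), Nat.div_eq_of_lt q6, zero_add]
    have e3 : (a + h * s) % s = a := by
      rw [Nat.add_mul_mod_self_right, Nat.mod_eq_of_lt q6]
    have e4 : r + (e - r) = e := by omega
    simp only [inv4, e1, e2, e3, e4, Prod.mk.injEq]
    have : h * e = e * h := mul_comm _ _
    refine ⟨by omega, trivial, by omega, by omega⟩

lemma QQ_sum (m : ℕ) (hm : m % 2 = 1) :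
    (m : ℤ) ≤ ∑ x ∈ QQ m, ZMod.χ₄ (x.1 : ZMod 4) * ZMod.χ₄ (x.2.2.1 : ZMod 4) := by
  have h1 := off_diag m hm
  have h2 : ∑ x ∈ (QQ m).filter (fun x => x.1 < x.2.2.1),
      ZMod.χ₄ (x.1 : ZMod 4) * ZMod.χ₄ (x.2.2.1 : ZMod 4) = 0 := by
    rw [← h1]
    apply Finset.sum_nbij' (fun x => (x.2.2.1, x.2.2.2, x.1, x.2.1))
      (fun x => (x.2.2.1, x.2.2.2, x.1, x.2.1))
    · rintro ⟨d, a, c, b⟩ hx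
      simp only [Finset.mem_filter, mem_QQ] at hx ⊢
      omega
    · rintro ⟨d, a, c, b⟩ hx
      simp only [Finset.mem_filter, mem_QQ] at hx ⊢
      omega
    · rintro ⟨d, a, c, b⟩ hx; rfl
    · rintro ⟨d, a, c, b⟩ hx; rfl
    · rintro ⟨d, a, c, b⟩ hx; exact mul_comm _ _
  have h3 : (m : ℤ) ≤ ∑ x ∈ (QQ m).filter (fun x => x.1 = x.2.2.1),
      ZMod.χ₄ (x.1 : ZMod 4) * ZMod.χ₄ (x.2.2.1 : ZMod 4) := by
    have : ∑ x ∈ (QQ m).filter (fun x => x.1 = x.2.2.1),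
      ZMod.χ₄ (x.1 : ZMod 4) * ZMod.χ₄ (x.2.2.1 : ZMod 4) =
      ∑ x ∈ (QQ m).filter (fun x => x.1 = x.2.2.1), 1 := by
      apply Finset.sum_congr rfl
      rintro ⟨d, a, c, b⟩ hx
      simp only [Finset.mem_filter, mem_QQ] at hx
      rw [chi_pair _ _ hx.1.1 hx.1.2.2.1, if_pos]
      omega
    rw [this, Finset.sum_const, nsmul_eq_mul, mul_one]
    norm_cast
    have := Finset.card_le_card_of_injOn (s := Finset.range m)
      (t := (QQ m).filter (fun x => x.1 = x.2.2.1)) (fun i => (1, 2*i+1, 1, 2*m - (2*i+1)))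
      (by
        intro i hi
        simp only [Finset.coe_range, Set.mem_Iio] at hi
        rw [Finset.mem_coe, Finset.mem_filter, mem_QQ]
        refine ⟨⟨rfl, by omega, rfl, by omega, by omega⟩, rfl⟩)
      (by
        intro i _ j _ he
        simp only [Prod.mk.injEq] at he
        omega)
    simpa using this
  have h4 := Finset.sum_filter_add_sum_filter_not (QQ m) (fun x => x.2.2.1 < x.1)
    (fun x => ZMod.χ₄ (x.1 : ZMod 4) * ZMod.χ₄ (x.2.2.1 : ZMod 4))
  have h5 := Finset.sum_filter_add_sum_filter_not ((QQ m).filter (fun x => ¬ x.2.2.1 < x.1))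
    (fun x => x.1 < x.2.2.1)
    (fun x => ZMod.χ₄ (x.1 : ZMod 4) * ZMod.χ₄ (x.2.2.1 : ZMod 4))
  rw [Finset.filter_filter, Finset.filter_filter] at h5
  have e1 : (QQ m).filter (fun x => ¬ x.2.2.1 < x.1 ∧ x.1 < x.2.2.1) =
      (QQ m).filter (fun x => x.1 < x.2.2.1) := by
    apply Finset.filter_congr; intros; omega
  have e2 : (QQ m).filter (fun x => ¬ x.2.2.1 < x.1 ∧ ¬ x.1 < x.2.2.1) =
      (QQ m).filter (fun x => x.1 = x.2.2.1) := by
    apply Finset.filter_congr; intros; omega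
  rw [e1, e2] at h5
  linarith

lemma conv_sum (m : ℕ) (hm : m % 2 = 1) :
    (m : ℤ) ≤ ∑ w ∈ (Finset.range (2*m+1)).filter (fun w => w % 2 = 1),
      (∑ d ∈ w.divisors, ZMod.χ₄ (d:ZMod 4)) *
      (∑ d ∈ (2*m-w).divisors, ZMod.χ₄ (d:ZMod 4)) := by
  refine (QQ_sum m hm).trans (le_of_eq ?_)
  have : ∀ w ∈ (Finset.range (2*m+1)).filter (fun w => w % 2 = 1),
      (∑ d ∈ w.divisors, ZMod.χ₄ (d:ZMod 4)) *
      (∑ d ∈ (2*m-w).divisors, ZMod.χ₄ (d:ZMod 4)) =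
      ∑ y ∈ w.divisors ×ˢ (2*m-w).divisors, ZMod.χ₄ (y.1:ZMod 4) * ZMod.χ₄ (y.2:ZMod 4) := by
    intro w _
    rw [Finset.sum_mul_sum, Finset.sum_product]
  rw [Finset.sum_congr rfl this, Finset.sum_sigma']
  apply Finset.sum_nbij' (fun x => ⟨x.1 * x.2.1, (x.1, x.2.2.1)⟩)
    (fun y => (y.2.1, y.1 / y.2.1, y.2.2, (2*m-y.1)/y.2.2))
  · rintro ⟨d, a, c, b⟩ hx
    rw [mem_QQ] at hx
    obtain ⟨h1, h2, h3, h4, h5⟩ := hx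
    have o1 : (d*a) % 2 = 1 := by rw [Nat.mul_mod, h1, h2]
    have o2 : (c*b) % 2 = 1 := by rw [Nat.mul_mod, h3, h4]
    have e : 2*m - d*a = c*b := by omega
    simp only [Finset.mem_sigma, Finset.mem_filter, Finset.mem_range, Finset.mem_product,
      Nat.mem_divisors, e]
    refine ⟨⟨by omega, o1⟩, ⟨dvd_mul_right _ _, by omega⟩, ⟨dvd_mul_right _ _, by omega⟩⟩
  · rintro ⟨w, d, c⟩ hx
    simp only [Finset.mem_sigma, Finset.mem_filter, Finset.mem_range, Finset.mem_product,
      Nat.mem_divisors] at hx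
    obtain ⟨⟨h1, h2⟩, ⟨⟨a, ha⟩, h4⟩, ⟨⟨b, hb⟩, h6⟩⟩ := hx
    have hd : 0 < d := by rcases Nat.eq_zero_or_pos d with h | h; · simp [h] at ha; omega
                          · exact h
    have hc : 0 < c := by rcases Nat.eq_zero_or_pos c with h | h; · simp [h] at hb; omega
                          · exact h
    have o1 := Nat.odd_mul.1 (Nat.odd_iff.2 (by omega : (d*a) % 2 = 1))
    have o2 := Nat.odd_mul.1 (Nat.odd_iff.2 (by omega : (c*b) % 2 = 1))
    simp only [Nat.odd_iff] at o1 o2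
    simp only [mem_QQ]
    rw [hb, ha, Nat.mul_div_cancel_left _ hd, Nat.mul_div_cancel_left _ hc]
    refine ⟨o1.1, o1.2, o2.1, o2.2, by omega⟩
  · rintro ⟨d, a, c, b⟩ hx
    rw [mem_QQ] at hx
    obtain ⟨h1, h2, h3, h4, h5⟩ := hx
    have e : 2*m - d*a = c*b := by omega
    simp only [e]
    rw [Nat.mul_div_cancel_left _ (by omega), Nat.mul_div_cancel_left _ (by omega)]
  · rintro ⟨w, d, c⟩ hx
    simp only [Finset.mem_sigma, Finset.mem_filter, Finset.mem_range, Finset.mem_product,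
      Nat.mem_divisors] at hx
    simp only [Nat.mul_div_cancel' hx.2.1.1]
  · rintro ⟨d, a, c, b⟩ hx; rfl

/-- pairs (odd, even) with sum of squares `w` -/
noncomputable def RR (w : ℕ) : Finset (ℤ × ℤ) :=
  (Finset.Icc (-(w:ℤ)) w ×ˢ Finset.Icc (-(w:ℤ)) w).filter
    (fun x => x.1 % 2 = 1 ∧ x.2 % 2 = 0 ∧ x.1 ^ 2 + x.2 ^ 2 = w)

lemma abs_le_of_sq {x n : ℤ} (h : x ^ 2 ≤ n) : -n ≤ x ∧ x ≤ n := by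
  constructor <;> nlinarith [Int.le_self_sq x, Int.le_self_sq (-x)]

lemma mem_RR (w : ℕ) (p q : ℤ) :
    (p, q) ∈ RR w ↔ p % 2 = 1 ∧ q % 2 = 0 ∧ p ^ 2 + q ^ 2 = w := by
  simp only [RR, Finset.mem_filter, Finset.mem_product, Finset.mem_Icc, and_iff_right_iff_imp]
  rintro ⟨_, _, h⟩
  exact ⟨abs_le_of_sq (by nlinarith [sq_nonneg q]), abs_le_of_sq (by nlinarith [sq_nonneg p])⟩

/-- rotate a Gaussian integer so that its real part is odd -/
def rot (α : GaussianInt) : GaussianInt := if α.re % 2 = 1 then α else ⟨-α.im, α.re⟩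

lemma dvd_rot (α : GaussianInt) : α ∣ rot α ∧ rot α ∣ α := by
  unfold rot
  split_ifs
  · exact ⟨dvd_rfl, dvd_rfl⟩
  · constructor
    · refine ⟨⟨0, 1⟩, ?_⟩
      apply Zsqrtd.ext <;> simp
    · refine ⟨⟨0, -1⟩, ?_⟩
      apply Zsqrtd.ext <;> simp

lemma rot_mem (w : ℕ) (hw : w % 2 = 1) (α : GaussianInt) (h : Zsqrtd.norm α = w) :
    ((rot α).re, (rot α).im) ∈ RR w := by
  rw [mem_RR]
  rw [Zsqrtd.norm_def] at h
  have h' : α.re ^ 2 + α.im ^ 2 = w := by rw [← h]; ring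
  have h2 : (α.re ^ 2 + α.im ^ 2) % 2 = 1 := by rw [h']; omega
  have par : ∀ x : ℤ, x ^ 2 % 2 = x % 2 := by
    intro x
    rcases Int.emod_two_eq_zero_or_one x with h | h <;> simp [pow_two, Int.mul_emod, h]
  have p1 := par α.re
  have p2 := par α.im
  unfold rot
  split_ifs with hc
  · exact ⟨hc, by omega, h'⟩
  · refine ⟨by simp only; omega, by simp only; omega, ?_⟩
    rw [← h']; simp only; ring

lemma RR_card (w : ℕ) (hw : w % 2 = 1) :
    0 ≤ ∑ d ∈ w.divisors, ZMod.χ₄ (d:ZMod 4) ∧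
    2 * ∑ d ∈ w.divisors, ZMod.χ₄ (d:ZMod 4) ≤ ((RR w).card : ℤ) := by
  obtain ⟨T, t1, t2, t3⟩ := good_exists w hw
  rw [← t3]
  refine ⟨by positivity, ?_⟩
  have := Finset.card_le_card_of_injOn (s := T ×ˢ ({1, -1} : Finset ℤ)) (t := RR w)
    (fun x => (x.2 * (rot x.1).re, x.2 * (rot x.1).im))
    (by
      rintro ⟨α, ε⟩ hx
      simp only [Finset.coe_product, Set.mem_prod, Finset.mem_coe, Finset.mem_insert,
        Finset.mem_singleton] at hx
      obtain ⟨hα, hε⟩ := hx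
      have := rot_mem w hw α (t1 _ hα)
      rw [mem_RR] at this
      rw [Finset.mem_coe, mem_RR]
      rcases hε with rfl | rfl
      · simpa using this
      · refine ⟨by simp only; omega, by simp only; omega, ?_⟩
        rw [← this.2.2]; simp only; ring)
    (by
      rintro ⟨α, ε⟩ hx ⟨β, δ⟩ hy he
      simp only [Finset.coe_product, Set.mem_prod, Finset.mem_coe, Finset.mem_insert,
        Finset.mem_singleton] at hx hy
      obtain ⟨hα, hε⟩ := hx
      obtain ⟨hβ, hδ⟩ := hy
      simp only [Prod.mk.injEq] at he
      have hd : rot α ∣ rot β := by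
        have hδ2 : δ * δ = 1 := by rcases hδ with rfl | rfl <;> norm_num
        refine ⟨((δ * ε : ℤ) : GaussianInt), ?_⟩
        apply Zsqrtd.ext
        · simp
          linear_combination (-(rot β).re) * hδ2 - δ * he.1
        · simp
          linear_combination (-(rot β).im) * hδ2 - δ * he.2
      have hab := t2 _ hα _ hβ (((dvd_rot α).1.trans hd).trans (dvd_rot β).2)
      subst hab
      have hm := rot_mem w hw α (t1 _ hα)
      rw [mem_RR] at hm
      have hne : (rot α).re ≠ 0 := by omega
      rw [mul_right_cancel₀ hne he.1])
  rw [Finset.card_product] at this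
  have h2 : ({1, -1} : Finset ℤ).card = 2 := by decide
  rw [h2] at this
  push_cast [← Int.ofNat_le] at this
  omega

noncomputable def F4 (m : ℕ) : Finset (ℤ × ℤ × ℤ × ℤ) :=
  (Finset.Icc (-(m:ℤ)) m ×ˢ Finset.Icc (-(m:ℤ)) m ×ˢ Finset.Icc (-(m:ℤ)) m ×ˢ
    Finset.Icc (-(m:ℤ)) m).filter
    (fun x => x.1 ^ 2 + x.2.1 ^ 2 + x.2.2.1 ^ 2 + x.2.2.2 ^ 2 = m)

lemma mem_F4 (m : ℕ) (a b c d : ℤ) :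
    (a, b, c, d) ∈ F4 m ↔ a ^ 2 + b ^ 2 + c ^ 2 + d ^ 2 = m := by
  simp only [F4, Finset.mem_filter, Finset.mem_product, Finset.mem_Icc, and_iff_right_iff_imp]
  intro h
  have := sq_nonneg a
  have := sq_nonneg b
  have := sq_nonneg c
  have := sq_nonneg d
  exact ⟨abs_le_of_sq (by linarith), abs_le_of_sq (by linarith), abs_le_of_sq (by linarith),
    abs_le_of_sq (by linarith)⟩

lemma F4_card (m : ℕ) (hm : m % 2 = 1) : 4 * m ≤ (F4 m).card := by
  have h1 := conv_sum m hm
  have h2 := Finset.card_le_card_of_injOn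
    (s := ((Finset.range (2*m+1)).filter (fun w => w % 2 = 1)).sigma
      (fun w => RR w ×ˢ RR (2*m-w))) (t := F4 m)
    (fun x => ((x.2.1.1 + x.2.2.1)/2, (x.2.1.1 - x.2.2.1)/2,
      (x.2.1.2 + x.2.2.2)/2, (x.2.1.2 - x.2.2.2)/2))
    (by
      rintro ⟨w, ⟨p, q⟩, ⟨u, v⟩⟩ hx
      rw [Finset.mem_coe] at hx ⊢
      simp only [Finset.mem_sigma, Finset.mem_filter, Finset.mem_range, Finset.mem_product,
        mem_RR] at hx
      obtain ⟨⟨a1, a2⟩, ⟨a3, a4, a5⟩, ⟨a6, a7, a8⟩⟩ := hx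
      rw [mem_F4]
      simp only
      obtain ⟨x, hx⟩ : ∃ x, p + u = 2 * x := ⟨(p+u)/2, by omega⟩
      obtain ⟨y, hy⟩ : ∃ y, p - u = 2 * y := ⟨(p-u)/2, by omega⟩
      obtain ⟨z, hz⟩ : ∃ z, q + v = 2 * z := ⟨(q+v)/2, by omega⟩
      obtain ⟨t, ht⟩ : ∃ t, q - v = 2 * t := ⟨(q-v)/2, by omega⟩
      rw [hx, hy, hz, ht]
      simp only [Int.mul_ediv_cancel_left _ (two_ne_zero)]
      have e1 : p = x + y := by omega
      have e2 : u = x - y := by omega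
      have e3 : q = z + t := by omega
      have e4 : v = z - t := by omega
      subst e1 e2 e3 e4
      push_cast [Nat.cast_sub (by omega : w ≤ 2 * m)] at a8
      linarith)
    (by
      rintro ⟨w, ⟨p, q⟩, ⟨u, v⟩⟩ hx ⟨w', ⟨p', q'⟩, ⟨u', v'⟩⟩ hy he
      rw [Finset.mem_coe] at hx hy
      simp only [Finset.mem_sigma, Finset.mem_filter, Finset.mem_range, Finset.mem_product,
        mem_RR] at hx hy
      simp only [Prod.mk.injEq] at he
      have e1 : p = p' := by omega
      have e2 : u = u' := by omega
      have e3 : q = q' := by omega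
      have e4 : v = v' := by omega
      subst e1 e2 e3 e4
      have : w = w' := by
        have := hx.2.1.2.2
        have := hy.2.1.2.2
        omega
      rw [this])
  rw [Finset.card_sigma] at h2
  simp only [Finset.card_product] at h2
  have h3 : (4 * m : ℤ) ≤ ∑ w ∈ (Finset.range (2*m+1)).filter (fun w => w % 2 = 1),
      ((RR w).card : ℤ) * ((RR (2*m-w)).card : ℤ) := by
    calc (4 * m : ℤ) ≤ 4 * ∑ w ∈ (Finset.range (2*m+1)).filter (fun w => w % 2 = 1),
          (∑ d ∈ w.divisors, ZMod.χ₄ (d:ZMod 4)) *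
          (∑ d ∈ (2*m-w).divisors, ZMod.χ₄ (d:ZMod 4)) := by linarith
      _ ≤ _ := by
          rw [Finset.mul_sum]
          apply Finset.sum_le_sum
          intro w hw
          rw [Finset.mem_filter, Finset.mem_range] at hw
          obtain ⟨b1, b2⟩ := RR_card w hw.2
          obtain ⟨b3, b4⟩ := RR_card (2*m-w) (by omega)
          have := mul_le_mul b2 b4 (by positivity) (by positivity)
          linarith
  have h4 : (∑ w ∈ (Finset.range (2*m+1)).filter (fun w => w % 2 = 1),
      (RR w).card * (RR (2*m-w)).card : ℤ) ≤ (F4 m).card := by exact_mod_cast h2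
  have := h3.trans h4
  exact_mod_cast this

noncomputable def box (k s : ℕ) : Finset (ℤ × ℤ) :=
  (Finset.Icc (-(s:ℤ)) s ×ˢ Finset.Icc (-(s:ℤ)) s).filter
    (fun x => x.1 ^ 2 + x.2 ^ 2 ≤ k ∧ ((k:ℤ) - x.1 ^ 2 - x.2 ^ 2) % 2 = 1)

lemma fin6 (k : ℕ) : {z : Fin 6 → ℤ | ∑ i, (z i) ^ 2 = (k : ℤ)}.Finite := by
  apply (Fintype.piFinset (fun _ : Fin 6 => Finset.Icc (-(k:ℤ)) k)).finite_toSet.subset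
  intro z hz
  change ∑ i, (z i) ^ 2 = (k : ℤ) at hz
  rw [Finset.mem_coe, Fintype.mem_piFinset]
  intro i
  rw [Finset.mem_Icc]
  apply abs_le_of_sq
  rw [← hz]
  exact Finset.single_le_sum (f := fun i => (z i)^2) (fun i _ => sq_nonneg _) (Finset.mem_univ i)

lemma lower6 (k s : ℕ) : ∑ x ∈ box k s, 4 * ((k:ℤ) - x.1 ^ 2 - x.2 ^ 2).toNat ≤
    {z : Fin 6 → ℤ | ∑ i, (z i) ^ 2 = (k : ℤ)}.ncard := by
  rw [Set.ncard_eq_toFinset_card _ (fin6 k)]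
  have h := Finset.card_le_card_of_injOn
    (s := (box k s).sigma (fun x => F4 ((k:ℤ) - x.1 ^ 2 - x.2 ^ 2).toNat))
    (t := (fin6 k).toFinset)
    (fun y => ![y.1.1, y.1.2, y.2.1, y.2.2.1, y.2.2.2.1, y.2.2.2.2])
    (by
      rintro ⟨⟨a, b⟩, c, d, e, f⟩ hx
      rw [Finset.mem_coe] at hx ⊢
      simp only [Finset.mem_sigma, box, Finset.mem_filter, mem_F4] at hx
      rw [Set.Finite.mem_toFinset]
      change ∑ i, _ = _
      simp [Fin.sum_univ_succ]
      have := hx.2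
      rw [Int.toNat_of_nonneg (by linarith [hx.1.2.1])] at this
      linarith)
    (by
      rintro ⟨⟨a, b⟩, c, d, e, f⟩ _ ⟨⟨a', b'⟩, c', d', e', f'⟩ _ he
      have e0 := congrFun he 0
      have e1 := congrFun he 1
      have e2 := congrFun he 2
      have e3 := congrFun he 3
      have e4 := congrFun he 4
      have e5 := congrFun he 5
      simp at e0 e1 e2 e3 e4 e5
      subst e0 e1 e2 e3 e4 e5
      rfl)
  rw [Finset.card_sigma] at h
  refine le_trans (Finset.sum_le_sum ?_) h
  rintro ⟨a, b⟩ hx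
  simp only [box, Finset.mem_filter] at hx
  apply F4_card
  simp only
  omega

lemma box_card (k s : ℕ) (hs : 4 * s ^ 2 ≤ k) : (2 * s + 1) * s ≤ (box k s).card := by
  have := Finset.card_le_card_of_injOn
    (s := Finset.range (2*s+1) ×ˢ Finset.range s) (t := box k s)
    (fun x => ((x.1:ℤ) - s, -(s:ℤ) + 2 * x.2 + ((x.1 + k + 1) % 2 : ℤ)))
    (by
      rintro ⟨i, j⟩ hx
      rw [Finset.mem_coe] at hx ⊢
      simp only [Finset.mem_product, Finset.mem_range] at hx
      simp only [box, Finset.mem_filter, Finset.mem_product, Finset.mem_Icc]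
      have b1 : -(s:ℤ) ≤ (i:ℤ) - s := by omega
      have b2 : (i:ℤ) - s ≤ s := by omega
      have b3 : -(s:ℤ) ≤ -(s:ℤ) + 2 * j + ((i + k + 1) % 2 : ℤ) := by omega
      have b4 : -(s:ℤ) + 2 * j + ((i + k + 1) % 2 : ℤ) ≤ s := by omega
      have b5 : ((i:ℤ) - s + (-(s:ℤ) + 2 * j + ((i + k + 1) % 2 : ℤ)) + k) % 2 = 1 := by omega
      have hs' : 4 * (s:ℤ) ^ 2 ≤ k := by exact_mod_cast hs
      generalize (i:ℤ) - s = a at *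
      generalize -(s:ℤ) + 2 * j + ((i + k + 1) % 2 : ℤ) = b at *
      have par : ∀ x : ℤ, x ^ 2 % 2 = x % 2 := by
        intro x
        rcases Int.emod_two_eq_zero_or_one x with h | h <;> simp [pow_two, Int.mul_emod, h]
      have pa := par a
      have pb := par b
      refine ⟨⟨⟨b1, b2⟩, b3, b4⟩, by nlinarith, by omega⟩)
    (by
      rintro ⟨i, j⟩ _ ⟨i', j'⟩ _ he
      simp only [Prod.mk.injEq] at he ⊢
      omega)
  simpa [Finset.card_product] using this

lemma big (k : ℕ) (hk : 16 ≤ k) :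
    (k + 2).choose 2 ≤ ∑ x ∈ box k (Nat.sqrt (k/4)), 4 * ((k:ℤ) - x.1 ^ 2 - x.2 ^ 2).toNat := by
  set s := Nat.sqrt (k/4) with hsd
  have h1 : s * s ≤ k / 4 := Nat.sqrt_le _
  have h2 : k / 4 < (s+1) * (s+1) := Nat.lt_succ_sqrt _
  have h1' : 4 * s ^ 2 ≤ k := by rw [pow_two]; omega
  have h2' : k < 4 * ((s+1) * (s+1)) := by omega
  have hs2 : 2 ≤ s := by rw [hsd, Nat.le_sqrt]; omega
  have hc := box_card k s h1'
  have h3 : (box k s).card * (2 * k) ≤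
      ∑ x ∈ box k s, 4 * ((k:ℤ) - x.1 ^ 2 - x.2 ^ 2).toNat := by
    rw [← smul_eq_mul]
    apply Finset.card_nsmul_le_sum
    rintro ⟨a, b⟩ hx
    simp only [box, Finset.mem_filter, Finset.mem_product, Finset.mem_Icc] at hx
    obtain ⟨⟨⟨b1, b2⟩, b3, b4⟩, _⟩ := hx
    have q1 : a ^ 2 ≤ (s:ℤ) ^ 2 := by nlinarith
    have q2 : b ^ 2 ≤ (s:ℤ) ^ 2 := by nlinarith
    have hs' : 4 * (s:ℤ) ^ 2 ≤ k := by exact_mod_cast h1'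
    simp only
    omega
  refine le_trans ?_ h3
  have h4 : (2*s+1)*s*(2*k) ≤ (box k s).card * (2 * k) := Nat.mul_le_mul_right _ hc
  refine le_trans ?_ h4
  rw [Nat.choose_two_right]
  have e : (k + 2) * (k + 2 - 1) = k * k + 3 * k + 2 := by
    rw [show k + 2 - 1 = k + 1 by omega]; ring
  rw [e]
  apply Nat.div_le_of_le_mul
  have h5 : k + 5 ≤ 4 * ((2*s+1)*s) := by nlinarith
  nlinarith

lemma small (k : ℕ) (hk : 0 < k) (hk2 : k < 16) :
    (k + 2).choose 2 ≤ ∑ x ∈ box k 3, 4 * ((k:ℤ) - x.1 ^ 2 - x.2 ^ 2).toNat := by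
  set_option maxRecDepth 100000 in
  interval_cases k <;> decide

/-- For every positive integer `k`, the number of integer vectors `z ∈ ℤ^6` with
`z₁² + ⋯ + z₆² = k` is at least `(k + 2).choose 2`. -/
theorem six_squares_lower (k : ℕ) (hk : 0 < k) :
    {z : Fin 6 → ℤ | ∑ i, (z i) ^ 2 = (k : ℤ)}.Finite ∧
      Nat.choose (k + 2) 2 ≤ {z : Fin 6 → ℤ | ∑ i, (z i) ^ 2 = (k : ℤ)}.ncard := by
  refine ⟨fin6 k, ?_⟩
  rcases Nat.lt_or_ge k 16 with h | h
  · exact (small k hk h).trans (lower6 k 3)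
  · exact (big k h).trans (lower6 k _)
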